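/- Let M be a nonsingular N×N Hermitian matrix and S a subspace of ℝ^N such that M|_S = P_S M P_S restricted to S is nonsingular. Then det(M) = det(M|_S) / det((M⁻¹)|_{S⊥}). -/

import Mathlib

open Matrix BigOperators

/-- Jacobi's complementary minor identity, in a basis adapted to a pair of complementary
orthonormal systems. -/
theorem Matrix.det_mul_det_compression_inv {R n p q : Type*} [CommRing R]
    [Fintype n] [DecidableEq n] [Fintype p] [DecidableEq p] [Fintype q] [DecidableEq q]
    (e : n ≃ p ⊕ q) (M : Matrix n n R) (hM : IsUnit M.det)
    (X : Matrix n p R) (Y : Matrix n q R)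
    (hX : Xᵀ * X = 1) (hY : Yᵀ * Y = 1) (hXY : Xᵀ * Y = 0) :
    M.det * (Yᵀ * M⁻¹ * Y).det = (Xᵀ * M * X).det := by
  have hYX : Yᵀ * X = 0 := by
    simpa using congrArg transpose hXY
  have hUU : fromRows Xᵀ Yᵀ * fromCols X Y = 1 := by
    rw [fromRows_mul_fromCols, hX, hY, hXY, hYX, fromBlocks_one]
  have hUU' : fromCols X Y * fromRows Xᵀ Yᵀ = 1 :=
    (mul_eq_one_comm_of_equiv e).2 hUU
  have hsum : X * Xᵀ + Y * Yᵀ = 1 := by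
    rwa [fromCols_mul_fromRows] at hUU'
  have hMY : X * (Xᵀ * M⁻¹ * Y) + Y * (Yᵀ * M⁻¹ * Y) = M⁻¹ * Y := by
    simp only [← Matrix.mul_assoc, ← Matrix.add_mul, hsum, Matrix.one_mul]
  have hblock : fromRows Xᵀ Yᵀ * M * fromCols X Y *
      fromBlocks 1 (Xᵀ * M⁻¹ * Y) 0 (Yᵀ * M⁻¹ * Y) =
      fromBlocks (Xᵀ * M * X) 0 (Yᵀ * M * X) 1 := by
    rw [Matrix.mul_assoc _ (fromCols X Y), fromCols_mul_fromBlocks, hMY, fromRows_mul,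
      fromRows_mul_fromCols]
    simp only [Matrix.mul_one, Matrix.mul_zero, add_zero, Matrix.mul_assoc,
      mul_nonsing_inv_cancel_left _ _ hM, hXY, hY]
  have hdet := congrArg det hblock
  rwa [det_mul, det_conj_of_mul_eq_one hUU hUU', det_fromBlocks_zero₂₁,
    det_fromBlocks_zero₁₂, det_one, det_one, one_mul, mul_one] at hdet

/-- Determinantal version of Haynsworth's theorem: with `S` the column span of a matrix `X`
with orthonormal columns and `X'` an orthonormal basis of `S⊥`,
`det M = det(M|_S) / det((M⁻¹)|_{S⊥})`. -/
theorem haynsworth_det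
    (N k l : ℕ) (hkl : k + l = N)
    (M : Matrix (Fin N) (Fin N) ℝ) (hM : M.IsHermitian) (hMinv : IsUnit M.det)
    (X : Matrix (Fin N) (Fin k) ℝ) (X' : Matrix (Fin N) (Fin l) ℝ)
    (hX : Xᵀ * X = 1) (hX' : X'ᵀ * X' = 1) (hperp : Xᵀ * X' = 0)
    (hSinv : IsUnit (Xᵀ * M * X).det) :
    M.det = (Xᵀ * M * X).det / (X'ᵀ * M⁻¹ * X').det := by
  have h := det_mul_det_compression_inv
    ((finCongr hkl.symm).trans finSumFinEquiv.symm) M hMinv X X' hX hX' hperp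
  refine eq_div_of_mul_eq (fun h0 => hSinv.ne_zero ?_) h
  rw [← h, h0, mul_zero]
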